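/- arXiv:2510.03883 — 2 statements merged into one kernel-verified Lean document; each statement's English description precedes it below -/
import Mathlib

section
/- There exists ε₀ > 0 such that for every ε with 0 < ε < ε₀, the polynomial function f : ℝ² → ℝ given by f(x,y) = x·(x + (y−1)² − 2)·(x + (y+1)² − 2) + ε·y⁶ has only nondegenerate critical points, and it has exactly eight critical points, of which exactly two are local minima, exactly five are saddles, and exactly one is a local maximum. -/
/-- A point `p = (x₀, y₀)` is a critical point of `f : ℝ → ℝ → ℝ` if both
partial derivatives of `f` vanish at `p`. -/
def IsCriticalPt (f : ℝ → ℝ → ℝ) (p : ℝ × ℝ) : Prop :=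
  deriv (fun t => f t p.2) p.1 = 0 ∧ deriv (fun t => f p.1 t) p.2 = 0

/-- The Hessian determinant `f_xx(p) * f_yy(p) - f_xy(p)^2` of `f` at `p`. -/
noncomputable def hessDet (f : ℝ → ℝ → ℝ) (p : ℝ × ℝ) : ℝ :=
  deriv (fun x => deriv (fun t => f t p.2) x) p.1 *
      deriv (fun y => deriv (fun t => f p.1 t) y) p.2 -
    (deriv (fun y => deriv (fun t => f t y) p.1) p.2) ^ 2

/-- `p` is a local minimum point of the function `(x, y) ↦ f x y`. -/
def IsLocMin (f : ℝ → ℝ → ℝ) (p : ℝ × ℝ) : Prop :=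
  IsLocalMin (fun q : ℝ × ℝ => f q.1 q.2) p

/-- `p` is a local maximum point of the function `(x, y) ↦ f x y`. -/
def IsLocMax (f : ℝ → ℝ → ℝ) (p : ℝ × ℝ) : Prop :=
  IsLocalMax (fun q : ℝ × ℝ => f q.1 q.2) p

/-- A saddle is a critical point that is neither a local minimum
nor a local maximum. -/
def IsSaddle (f : ℝ → ℝ → ℝ) (p : ℝ × ℝ) : Prop :=
  IsCriticalPt f p ∧ ¬ IsLocMin f p ∧ ¬ IsLocMax f p

/-- Realizing family for `J₁₀³` with eight critical points and one maximum. -/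
noncomputable def f13 (ε : ℝ) : ℝ → ℝ → ℝ := fun x y =>
  x * (x + (y - 1) ^ 2 - 2) * (x + (y + 1) ^ 2 - 2) + ε * y ^ 6

lemma deriv_f13_fst (ε x y : ℝ) :
    deriv (fun t => f13 ε t y) x =
      3 * x ^ 2 + 4 * x * (y ^ 2 - 1) + (y ^ 2 - 1) ^ 2 - 4 * y ^ 2 := by
  have h1 := (hasDerivAt_id x).add_const ((y - 1) ^ 2 - 2)
  have h2 := (hasDerivAt_id x).add_const ((y + 1) ^ 2 - 2)
  have h := (((hasDerivAt_id x).mul h1).mul h2).add_const (ε * y ^ 6)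
  have e : (fun t => f13 ε t y) = fun t =>
      t * (t + ((y - 1) ^ 2 - 2)) * (t + ((y + 1) ^ 2 - 2)) + ε * y ^ 6 := by
    funext t
    simp only [f13]
    ring
  rw [e]
  refine HasDerivAt.deriv (HasDerivAt.congr_deriv h ?_)
  simp
  ring

lemma deriv_f13_snd (ε x y : ℝ) :
    deriv (fun t => f13 ε x t) y =
      y * (4 * x * (x + y ^ 2 - 3) + 6 * ε * y ^ 4) := by
  have h := (((hasDerivAt_pow 4 y).const_mul x).add
    ((hasDerivAt_pow 2 y).const_mul (2 * x * (x - 3)))).add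
    (((hasDerivAt_pow 6 y).const_mul ε).add_const (x * (x - 1) ^ 2))
  have e : (fun t => f13 ε x t) = fun t =>
      x * t ^ 4 + 2 * x * (x - 3) * t ^ 2 + (ε * t ^ 6 + x * (x - 1) ^ 2) := by
    funext t
    simp only [f13]
    ring
  rw [e]
  refine HasDerivAt.deriv (HasDerivAt.congr_deriv h ?_)
  norm_num
  ring

lemma isCriticalPt_f13_iff (ε x y : ℝ) :
    IsCriticalPt (f13 ε) (x, y) ↔
      3 * x ^ 2 + 4 * x * (y ^ 2 - 1) + (y ^ 2 - 1) ^ 2 - 4 * y ^ 2 = 0 ∧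
        y * (4 * x * (x + y ^ 2 - 3) + 6 * ε * y ^ 4) = 0 := by
  simp only [IsCriticalPt, deriv_f13_fst, deriv_f13_snd]

lemma hessDet_f13 (ε x y : ℝ) :
    hessDet (f13 ε) (x, y) =
      4 * (3 * x + 2 * y ^ 2 - 2) * (2 * x * (x + 3 * y ^ 2 - 3) + 15 * ε * y ^ 4) -
        (4 * y * (2 * x + y ^ 2 - 3)) ^ 2 := by
  simp only [hessDet, deriv_f13_fst, deriv_f13_snd]
  have h1 : deriv (fun t : ℝ => 3 * t ^ 2 + 4 * t * (y ^ 2 - 1) + (y ^ 2 - 1) ^ 2 - 4 * y ^ 2) x =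
      2 * (3 * x + 2 * y ^ 2 - 2) := by
    have h := (((hasDerivAt_pow 2 x).const_mul 3).add
      ((hasDerivAt_id x).const_mul (4 * (y ^ 2 - 1)))).add_const ((y ^ 2 - 1) ^ 2 - 4 * y ^ 2)
    have e : (fun t : ℝ => 3 * t ^ 2 + 4 * t * (y ^ 2 - 1) + (y ^ 2 - 1) ^ 2 - 4 * y ^ 2) =
        fun t => 3 * t ^ 2 + 4 * (y ^ 2 - 1) * t + ((y ^ 2 - 1) ^ 2 - 4 * y ^ 2) := by
      funext t
      ring
    rw [e]
    refine HasDerivAt.deriv (HasDerivAt.congr_deriv h ?_)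
    norm_num
    ring
  have h2 : deriv (fun t : ℝ => t * (4 * x * (x + t ^ 2 - 3) + 6 * ε * t ^ 4)) y =
      2 * (2 * x * (x + 3 * y ^ 2 - 3) + 15 * ε * y ^ 4) := by
    have h := ((hasDerivAt_id y).const_mul (4 * x * (x - 3))).add
      (((hasDerivAt_pow 3 y).const_mul (4 * x)).add ((hasDerivAt_pow 5 y).const_mul (6 * ε)))
    have e : (fun t : ℝ => t * (4 * x * (x + t ^ 2 - 3) + 6 * ε * t ^ 4)) =
        fun t => 4 * x * (x - 3) * t + (4 * x * t ^ 3 + 6 * ε * t ^ 5) := by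
      funext t
      ring
    rw [e]
    refine HasDerivAt.deriv (HasDerivAt.congr_deriv h ?_)
    norm_num
    ring
  have h3 : deriv (fun t : ℝ => 3 * x ^ 2 + 4 * x * (t ^ 2 - 1) + (t ^ 2 - 1) ^ 2 - 4 * t ^ 2) y =
      4 * y * (2 * x + y ^ 2 - 3) := by
    have h := ((hasDerivAt_pow 4 y).add ((hasDerivAt_pow 2 y).const_mul (4 * x - 6))).add_const
      (3 * x ^ 2 - 4 * x + 1)
    have e : (fun t : ℝ => 3 * x ^ 2 + 4 * x * (t ^ 2 - 1) + (t ^ 2 - 1) ^ 2 - 4 * t ^ 2) =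
        fun t => t ^ 4 + (4 * x - 6) * t ^ 2 + (3 * x ^ 2 - 4 * x + 1) := by
      funext t
      ring
    rw [e]
    refine HasDerivAt.deriv (HasDerivAt.congr_deriv h ?_)
    norm_num
    ring
  rw [h1, h2, h3]
  ring

/-- `g` is, around `p`, its value at `p` plus a quadratic form in `q - p` whose coefficients
depend continuously on `q` and equal `a`, `b`, `c` at `p`. -/
def HasQuadraticExpansion (g : ℝ × ℝ → ℝ) (p : ℝ × ℝ) (a b c : ℝ) : Prop :=
  ∃ A B C : ℝ × ℝ → ℝ, Continuous A ∧ Continuous B ∧ Continuous C ∧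
    A p = a ∧ B p = b ∧ C p = c ∧
    ∀ q, g q = g p + (A q * (q.1 - p.1) ^ 2 + B q * ((q.1 - p.1) * (q.2 - p.2)) +
      C q * (q.2 - p.2) ^ 2)

namespace HasQuadraticExpansion

variable {g : ℝ × ℝ → ℝ} {p : ℝ × ℝ} {a b c : ℝ}

lemma neg (h : HasQuadraticExpansion g p a b c) :
    HasQuadraticExpansion (fun q => -g q) p (-a) (-b) (-c) := by
  obtain ⟨A, B, C, hA, hB, hC, ha, hb, hc, hg⟩ := h
  refine ⟨fun q => -A q, fun q => -B q, fun q => -C q, hA.neg, hB.neg, hC.neg,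
    by simp [ha], by simp [hb], by simp [hc], fun q => ?_⟩
  simp only [hg q]
  ring

lemma isLocalMin (h : HasQuadraticExpansion g p a b c) (ha : 0 < a)
    (hd : 0 < 4 * a * c - b ^ 2) : IsLocalMin g p := by
  obtain ⟨A, B, C, hA, hB, hC, rfl, rfl, rfl, hg⟩ := h
  have hD : Continuous fun q => 4 * A q * C q - B q ^ 2 := by fun_prop
  filter_upwards [hA.continuousAt.eventually (lt_mem_nhds ha),
    hD.continuousAt.eventually (lt_mem_nhds hd)] with q h1 h2
  rw [hg q]
  set u := q.1 - p.1
  set v := q.2 - p.2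
  have key : 0 ≤ 4 * A q * (A q * u ^ 2 + B q * (u * v) + C q * v ^ 2) := by
    have e : 4 * A q * (A q * u ^ 2 + B q * (u * v) + C q * v ^ 2) =
        (2 * A q * u + B q * v) ^ 2 + (4 * A q * C q - B q ^ 2) * v ^ 2 := by ring
    rw [e]
    positivity
  have := nonneg_of_mul_nonneg_right key (by positivity)
  linarith

lemma not_isLocalMax (h : HasQuadraticExpansion g p a b c) (u v : ℝ)
    (hpos : 0 < a * u ^ 2 + b * (u * v) + c * v ^ 2) : ¬ IsLocalMax g p := by
  obtain ⟨A, B, C, hA, hB, hC, rfl, rfl, rfl, hg⟩ := h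
  intro hmax
  have hl : Continuous fun t : ℝ => (p.1 + t * u, p.2 + t * v) := by fun_prop
  have hl0 : Filter.Tendsto (fun t : ℝ => (p.1 + t * u, p.2 + t * v)) (nhds 0) (nhds p) := by
    have := hl.tendsto 0
    simpa using this
  have hQ : Continuous fun q => A q * u ^ 2 + B q * (u * v) + C q * v ^ 2 := by fun_prop
  have h1 := hl0.eventually hmax
  have h2 := hl0.eventually (hQ.continuousAt.eventually (lt_mem_nhds hpos))
  have h3 : ∀ᶠ t in nhdsWithin (0 : ℝ) {0}ᶜ, False := by
    filter_upwards [nhdsWithin_le_nhds h1, nhdsWithin_le_nhds h2, self_mem_nhdsWithin]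
      with t h1 h2 ht
    rw [hg] at h1
    simp only [add_sub_cancel_left] at h1
    have ht' : 0 < t ^ 2 := by
      have : t ≠ 0 := ht
      positivity
    have := mul_pos ht' h2
    nlinarith
  exact (Filter.eventually_false_iff_eq_bot.1 h3 ▸ (inferInstance :
    (nhdsWithin (0 : ℝ) {0}ᶜ).NeBot)).ne rfl

lemma isLocalMax (h : HasQuadraticExpansion g p a b c) (ha : a < 0)
    (hd : 0 < 4 * a * c - b ^ 2) : IsLocalMax g p := by
  have := (h.neg.isLocalMin (by linarith) (by linarith)).neg
  simpa using this

lemma not_isLocalMin (h : HasQuadraticExpansion g p a b c) (u v : ℝ)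
    (hneg : a * u ^ 2 + b * (u * v) + c * v ^ 2 < 0) : ¬ IsLocalMin g p :=
  fun hmin => h.neg.not_isLocalMax u v (by linarith) hmin.neg

lemma not_isLocalMax_of_disc_neg (h : HasQuadraticExpansion g p a b c)
    (hd : 4 * a * c - b ^ 2 < 0) : ¬ IsLocalMax g p := by
  rcases lt_trichotomy a 0 with ha | ha | ha
  · refine h.not_isLocalMax (-b) (2 * a) ?_
    have := mul_pos_of_neg_of_neg ha hd
    linarith
  · subst ha
    have hb : b ≠ 0 := by
      rintro rfl
      simp at hd
    refine h.not_isLocalMax ((1 - c) / b) 1 ?_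
    have e : b * ((1 - c) / b) = 1 - c := mul_div_cancel₀ _ hb
    rw [mul_one, e]
    linarith
  · exact h.not_isLocalMax 1 0 (by linarith)

lemma not_isLocalMin_of_disc_neg (h : HasQuadraticExpansion g p a b c)
    (hd : 4 * a * c - b ^ 2 < 0) : ¬ IsLocalMin g p :=
  fun hmin => h.neg.not_isLocalMax_of_disc_neg (by linarith) hmin.neg

end HasQuadraticExpansion

lemma IsCriticalPt.hasQuadraticExpansion_f13 {ε x y : ℝ} (h : IsCriticalPt (f13 ε) (x, y)) :
    HasQuadraticExpansion (fun q => f13 ε q.1 q.2) (x, y) (3 * x + 2 * y ^ 2 - 2)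
      (4 * y * (2 * x + y ^ 2 - 3)) (2 * x * (x + 3 * y ^ 2 - 3) + 15 * ε * y ^ 4) := by
  obtain ⟨h1, h2⟩ := (isCriticalPt_f13_iff ε x y).1 h
  refine ⟨fun q => 3 * x + 2 * y ^ 2 - 2 + ((q.1 - x) + (q.2 - y) * (q.2 + y)),
    fun q => (q.2 + y) * (4 * x + 2 * y ^ 2 - 6 + ((q.1 - x) + (q.2 - y) * (q.2 + y))),
    fun q => x * (2 * (x + y ^ 2 - 3) + (q.2 + y) ^ 2) +
      ε * (15 * y ^ 4 + 20 * y ^ 3 * (q.2 - y) + 15 * y ^ 2 * (q.2 - y) ^ 2 +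
        6 * y * (q.2 - y) ^ 3 + (q.2 - y) ^ 4),
    by fun_prop, by fun_prop, by fun_prop, ?_, ?_, ?_, fun q => ?_⟩
  · simp
  · simp only
    ring
  · simp only
    ring
  · simp only [f13]
    linear_combination (q.1 - x) * h1 + (q.2 - y) * h2

lemma IsCriticalPt.f13_locMin {ε x y : ℝ} (h : IsCriticalPt (f13 ε) (x, y))
    (hd : 0 < hessDet (f13 ε) (x, y)) (ha : 0 < 3 * x + 2 * y ^ 2 - 2) :
    IsLocMin (f13 ε) (x, y) ∧ ¬ IsLocMax (f13 ε) (x, y) := by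
  rw [hessDet_f13] at hd
  exact ⟨h.hasQuadraticExpansion_f13.isLocalMin ha hd,
    h.hasQuadraticExpansion_f13.not_isLocalMax 1 0 (by linarith)⟩

lemma IsCriticalPt.f13_locMax {ε x y : ℝ} (h : IsCriticalPt (f13 ε) (x, y))
    (hd : 0 < hessDet (f13 ε) (x, y)) (ha : 3 * x + 2 * y ^ 2 - 2 < 0) :
    ¬ IsLocMin (f13 ε) (x, y) ∧ IsLocMax (f13 ε) (x, y) := by
  rw [hessDet_f13] at hd
  exact ⟨h.hasQuadraticExpansion_f13.not_isLocalMin 1 0 (by linarith),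
    h.hasQuadraticExpansion_f13.isLocalMax ha hd⟩

lemma IsCriticalPt.f13_saddle {ε x y : ℝ} (h : IsCriticalPt (f13 ε) (x, y))
    (hd : hessDet (f13 ε) (x, y) < 0) :
    ¬ IsLocMin (f13 ε) (x, y) ∧ ¬ IsLocMax (f13 ε) (x, y) := by
  rw [hessDet_f13] at hd
  exact ⟨h.hasQuadraticExpansion_f13.not_isLocalMin_of_disc_neg hd,
    h.hasQuadraticExpansion_f13.not_isLocalMax_of_disc_neg hd⟩

/-- The quartic whose roots `d = x + y ^ 2 - 1` parametrize the critical points off the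
axis `y = 0`. -/
def critQuartic (ε d : ℝ) : ℝ :=
  4 * (4 + 4 * d - d ^ 2) * (d ^ 2 - 4) + 3 * ε * d ^ 2 * (3 * d + 2) ^ 2

/-- The derivative of `critQuartic ε`. -/
def critQuarticDeriv (ε d : ℝ) : ℝ :=
  4 * (4 - 2 * d) * (d ^ 2 - 4) + 8 * d * (4 + 4 * d - d ^ 2) +
    12 * ε * d * (3 * d + 2) * (3 * d + 1)

/-- The `x`-coordinate of the critical points with parameter `d`. -/
noncomputable def critX (d : ℝ) : ℝ := (4 + 4 * d - d ^ 2) / (2 * (d + 2))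

/-- The square of the `y`-coordinate of the critical points with parameter `d`. -/
noncomputable def critYSq (d : ℝ) : ℝ := d * (3 * d + 2) / (2 * (d + 2))

lemma critX_add_critYSq {d : ℝ} (hd : d + 2 ≠ 0) : critX d + critYSq d = d + 1 := by
  simp only [critX, critYSq]
  field_simp
  ring

lemma isCriticalPt_f13_of_root {ε d y : ℝ} (hd : d + 2 ≠ 0) (hy : y ^ 2 = critYSq d)
    (h : critQuartic ε d = 0) : IsCriticalPt (f13 ε) (critX d, y) := by
  rw [isCriticalPt_f13_iff, show y ^ 4 = (y ^ 2) ^ 2 by ring, hy]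
  have h1 : 4 * critX d * (critX d + critYSq d - 3) + 6 * ε * critYSq d ^ 2 = 0 := by
    rw [critX_add_critYSq hd]
    simp only [critX, critYSq, critQuartic] at *
    field_simp
    linear_combination 2 * h
  refine ⟨?_, by rw [h1, mul_zero]⟩
  simp only [critX, critYSq]
  field_simp
  ring

lemma critQuartic_of_isCriticalPt {ε x y : ℝ} (hy : y ≠ 0) (h : IsCriticalPt (f13 ε) (x, y)) :
    ∃ d, d + 2 ≠ 0 ∧ critQuartic ε d = 0 ∧ x = critX d ∧ y ^ 2 = critYSq d := by
  obtain ⟨h1, h2⟩ := (isCriticalPt_f13_iff ε x y).1 h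
  have h2 := (mul_eq_zero.1 h2).resolve_left hy
  obtain ⟨d, hd⟩ : ∃ d, d = x + y ^ 2 - 1 := ⟨_, rfl⟩
  have hy2 : y ^ 2 = d - x + 1 := by linarith
  rw [show y ^ 4 = (y ^ 2) ^ 2 by ring] at h2
  rw [hy2] at h1 h2
  have hd2 : d + 2 ≠ 0 := by
    intro h0
    have : d = -2 := by linarith
    subst this
    nlinarith
  have hx : x = critX d := by
    rw [critX, eq_div_iff (by simpa using hd2)]
    linear_combination h1
  have hT : y ^ 2 = critYSq d := by
    have := critX_add_critYSq hd2
    linarith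
  refine ⟨d, hd2, ?_, hx, hT⟩
  rw [← hy2, hT, show x + critYSq d - 3 = d - 2 by linarith, hx] at h2
  simp only [critX, critYSq] at h2
  field_simp at h2
  simp only [critQuartic]
  linear_combination h2 / 2

lemma hessDet_f13_of_root {ε d y : ℝ} (hd : d + 2 ≠ 0) (hy : y ^ 2 = critYSq d)
    (h : critQuartic ε d = 0) :
    hessDet (f13 ε) (critX d, y) = d * (3 * d + 2) * critQuarticDeriv ε d / (d + 2) ^ 2 := by
  rw [hessDet_f13, mul_pow, mul_pow, show y ^ 4 = (y ^ 2) ^ 2 by ring, hy]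
  have key : 4 * (3 * critX d + 2 * critYSq d - 2) *
        (2 * critX d * (critX d + 3 * critYSq d - 3) + 15 * ε * critYSq d ^ 2) -
        4 ^ 2 * critYSq d * (2 * critX d + critYSq d - 3) ^ 2 =
      d * (3 * d + 2) * critQuarticDeriv ε d / (d + 2) ^ 2 +
        (3 * d ^ 2 + 12 * d + 4 - 4 * (d * (3 * d + 2))) / (2 * (d + 2) ^ 3) *
          critQuartic ε d := by
    simp only [critX, critYSq, critQuarticDeriv, critQuartic]
    field_simp
    ring
  rw [key, h, mul_zero, add_zero]

lemma cubic_coeffs_eq_zero {a b c d k₀ k₁ k₂ k₃ : ℝ} (hab : a ≠ b) (hac : a ≠ c) (had : a ≠ d)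
    (hbc : b ≠ c) (hbd : b ≠ d) (hcd : c ≠ d)
    (ha : k₃ * a ^ 3 + k₂ * a ^ 2 + k₁ * a + k₀ = 0)
    (hb : k₃ * b ^ 3 + k₂ * b ^ 2 + k₁ * b + k₀ = 0)
    (hc : k₃ * c ^ 3 + k₂ * c ^ 2 + k₁ * c + k₀ = 0)
    (hd : k₃ * d ^ 3 + k₂ * d ^ 2 + k₁ * d + k₀ = 0) :
    k₃ = 0 ∧ k₂ = 0 ∧ k₁ = 0 ∧ k₀ = 0 := by
  have eb : k₃ * (a ^ 2 + a * b + b ^ 2) + k₂ * (a + b) + k₁ = 0 :=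
    mul_left_cancel₀ (sub_ne_zero.2 hab) (by linear_combination ha - hb)
  have ec : k₃ * (a ^ 2 + a * c + c ^ 2) + k₂ * (a + c) + k₁ = 0 :=
    mul_left_cancel₀ (sub_ne_zero.2 hac) (by linear_combination ha - hc)
  have ed : k₃ * (a ^ 2 + a * d + d ^ 2) + k₂ * (a + d) + k₁ = 0 :=
    mul_left_cancel₀ (sub_ne_zero.2 had) (by linear_combination ha - hd)
  have fc : k₃ * (a + b + c) + k₂ = 0 :=
    mul_left_cancel₀ (sub_ne_zero.2 hbc) (by linear_combination eb - ec)
  have fd : k₃ * (a + b + d) + k₂ = 0 :=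
    mul_left_cancel₀ (sub_ne_zero.2 hbd) (by linear_combination eb - ed)
  have h3 : k₃ = 0 :=
    mul_left_cancel₀ (sub_ne_zero.2 hcd) (by linear_combination fc - fd)
  subst h3
  have h2 : k₂ = 0 := by linarith
  subst h2
  have h1 : k₁ = 0 := by linarith
  subst h1
  exact ⟨rfl, rfl, rfl, by linarith⟩

lemma exists_critQuartic_root {ε a b : ℝ} (hab : a ≤ b)
    (h : critQuartic ε a < 0 ∧ 0 < critQuartic ε b ∨ critQuartic ε b < 0 ∧ 0 < critQuartic ε a) :
    ∃ d ∈ Set.Ioo a b, critQuartic ε d = 0 := by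
  have hc : ContinuousOn (critQuartic ε) (Set.Icc a b) := by
    unfold critQuartic
    fun_prop
  rcases h with h | h
  · exact intermediate_value_Ioo hab hc h
  · exact intermediate_value_Ioo' hab hc h

lemma critQuartic_roots {ε : ℝ} (h0 : 0 < ε) (h1 : ε < 1 / 1000) :
    ∃ d₂ d₃ d₄ : ℝ, d₂ ∈ Set.Ioo (-2) (-2 / 3) ∧ d₃ ∈ Set.Ioo 1 2 ∧ d₄ ∈ Set.Ioo 2 5 ∧
      critQuartic ε d₂ = 0 ∧ critQuartic ε d₃ = 0 ∧ critQuartic ε d₄ = 0 ∧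
      critQuarticDeriv ε d₂ < 0 ∧ 0 < critQuarticDeriv ε d₃ ∧ critQuarticDeriv ε d₄ < 0 ∧
      ∀ d, -2 < d → critQuartic ε d = 0 → d = d₂ ∨ d = d₃ ∨ d = d₄ := by
  obtain ⟨d₁, i₁, r₁⟩ := exists_critQuartic_root (ε := ε) (a := -3) (b := -2) (by norm_num)
    (.inl (by norm_num [critQuartic]; constructor <;> linarith))
  obtain ⟨d₂, i₂, r₂⟩ := exists_critQuartic_root (ε := ε) (a := -2) (b := -2 / 3) (by norm_num)
    (.inr (by norm_num [critQuartic]; linarith))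
  obtain ⟨d₃, i₃, r₃⟩ := exists_critQuartic_root (ε := ε) (a := 1) (b := 2) (by norm_num)
    (.inl (by norm_num [critQuartic]; constructor <;> linarith))
  obtain ⟨d₄, i₄, r₄⟩ := exists_critQuartic_root (ε := ε) (a := 2) (b := 5) (by norm_num)
    (.inr (by norm_num [critQuartic]; constructor <;> linarith))
  obtain ⟨l₁, u₁⟩ := i₁
  obtain ⟨l₂, u₂⟩ := i₂
  obtain ⟨l₃, u₃⟩ := i₃
  obtain ⟨l₄, u₄⟩ := i₄
  obtain ⟨k, hk⟩ : ∃ k, k = 27 * ε - 4 := ⟨_, rfl⟩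
  have hk0 : k < 0 := by linarith
  obtain ⟨e₃, e₂, e₁, e₀⟩ := cubic_coeffs_eq_zero
    (a := d₁) (b := d₂) (c := d₃) (d := d₄)
    (k₃ := 16 + 36 * ε + k * (d₁ + d₂ + d₃ + d₄))
    (k₂ := 32 + 12 * ε - k * (d₁ * d₂ + d₁ * d₃ + d₁ * d₄ + d₂ * d₃ + d₂ * d₄ + d₃ * d₄))
    (k₁ := -64 + k * (d₁ * d₂ * d₃ + d₁ * d₂ * d₄ + d₁ * d₃ * d₄ + d₂ * d₃ * d₄))
    (k₀ := -64 - k * (d₁ * d₂ * d₃ * d₄))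
    (by linarith) (by linarith) (by linarith) (by linarith) (by linarith) (by linarith)
    (by rw [critQuartic] at r₁; rw [hk]; linear_combination r₁)
    (by rw [critQuartic] at r₂; rw [hk]; linear_combination r₂)
    (by rw [critQuartic] at r₃; rw [hk]; linear_combination r₃)
    (by rw [critQuartic] at r₄; rw [hk]; linear_combination r₄)
  have hfac : ∀ t, critQuartic ε t = k * ((t - d₁) * (t - d₂) * (t - d₃) * (t - d₄)) := by
    intro t
    rw [critQuartic]
    linear_combination t ^ 3 * e₃ + t ^ 2 * e₂ + t * e₁ + e₀ - t ^ 4 * hk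
  have hder : ∀ t, critQuarticDeriv ε t =
      k * ((t - d₂) * (t - d₃) * (t - d₄) + (t - d₁) * (t - d₃) * (t - d₄) +
        (t - d₁) * (t - d₂) * (t - d₄) + (t - d₁) * (t - d₂) * (t - d₃)) := by
    intro t
    rw [critQuarticDeriv]
    linear_combination 3 * t ^ 2 * e₃ + 2 * t * e₂ + e₁ - 4 * t ^ 3 * hk
  have p12 : 0 < d₂ - d₁ := by linarith
  have p13 : 0 < d₃ - d₁ := by linarith
  have p14 : 0 < d₄ - d₁ := by linarith
  have p23 : 0 < d₃ - d₂ := by linarith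
  have p24 : 0 < d₄ - d₂ := by linarith
  have p34 : 0 < d₄ - d₃ := by linarith
  have pk : 0 < -k := by linarith
  refine ⟨d₂, d₃, d₄, ⟨l₂, u₂⟩, ⟨l₃, u₃⟩, ⟨l₄, u₄⟩, r₂, r₃, r₄, ?_, ?_, ?_, ?_⟩
  · have : 0 < -k * ((d₂ - d₁) * (d₃ - d₂) * (d₄ - d₂)) := by positivity
    rw [hder]
    linarith
  · have : 0 < -k * ((d₃ - d₁) * (d₃ - d₂) * (d₄ - d₃)) := by positivity
    rw [hder]
    linarith
  · have : 0 < -k * ((d₄ - d₁) * (d₄ - d₂) * (d₄ - d₃)) := by positivity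
    rw [hder]
    linarith
  · intro d hd h
    rw [hfac] at h
    have hd1 : d - d₁ ≠ 0 := by linarith
    simpa [hk0.ne, hd1, sub_eq_zero, or_assoc] using h

lemma critYSq_pos_iff {d : ℝ} (hd : d + 2 ≠ 0) :
    0 < critYSq d ↔ 0 < d * (3 * d + 2) * (d + 2) := by
  have : critYSq d = d * (3 * d + 2) * (d + 2) / (2 * (d + 2) ^ 2) := by
    rw [critYSq]
    field_simp
  rw [this, div_pos_iff_of_pos_right (by positivity)]

/-- The classification of the critical points of `f13 ε`: the two on the axis `y = 0` and
three mirror pairs `(xᵢ, ± yᵢ)`. -/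
lemma exists_critical_points {ε : ℝ} (h0 : 0 < ε) (h1 : ε < 1 / 1000) :
    ∃ x₂ y₂ x₃ y₃ x₄ y₄ : ℝ, 0 < y₂ ∧ 0 < y₃ ∧ 0 < y₄ ∧
      (x₂, y₂) ≠ (x₃, y₃) ∧ (x₂, y₂) ≠ (x₄, y₄) ∧ (x₃, y₃) ≠ (x₄, y₄) ∧
      (∀ p, IsCriticalPt (f13 ε) p ↔ p = (1, 0) ∨ p = (1 / 3, 0) ∨ p = (x₂, y₂) ∨
        p = (x₂, -y₂) ∨ p = (x₃, y₃) ∨ p = (x₃, -y₃) ∨ p = (x₄, y₄) ∨ p = (x₄, -y₄)) ∧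
      hessDet (f13 ε) (1, 0) < 0 ∧
      0 < hessDet (f13 ε) (1 / 3, 0) ∧
      hessDet (f13 ε) (x₂, y₂) < 0 ∧ hessDet (f13 ε) (x₂, -y₂) < 0 ∧
      0 < hessDet (f13 ε) (x₃, y₃) ∧ 0 < hessDet (f13 ε) (x₃, -y₃) ∧
      hessDet (f13 ε) (x₄, y₄) < 0 ∧ hessDet (f13 ε) (x₄, -y₄) < 0 ∧
      0 < 3 * x₃ + 2 * y₃ ^ 2 - 2 := by
  obtain ⟨d₂, d₃, d₄, ⟨l₂, u₂⟩, ⟨l₃, u₃⟩, ⟨l₄, u₄⟩, r₂, r₃, r₄, D₂, D₃, D₄, huniq⟩ :=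
    critQuartic_roots h0 h1
  have n₂ : d₂ + 2 ≠ 0 := by linarith
  have n₃ : d₃ + 2 ≠ 0 := by linarith
  have n₄ : d₄ + 2 ≠ 0 := by linarith
  have m₂ : 0 < d₂ * (3 * d₂ + 2) := mul_pos_of_neg_of_neg (by linarith) (by linarith)
  have m₃ : 0 < d₃ * (3 * d₃ + 2) := mul_pos (by linarith) (by linarith)
  have m₄ : 0 < d₄ * (3 * d₄ + 2) := mul_pos (by linarith) (by linarith)
  have t₂ : 0 < critYSq d₂ := (critYSq_pos_iff n₂).2 (mul_pos m₂ (by linarith))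
  have t₃ : 0 < critYSq d₃ := (critYSq_pos_iff n₃).2 (mul_pos m₃ (by linarith))
  have t₄ : 0 < critYSq d₄ := (critYSq_pos_iff n₄).2 (mul_pos m₄ (by linarith))
  have s₂ := Real.sq_sqrt t₂.le
  have s₃ := Real.sq_sqrt t₃.le
  have s₄ := Real.sq_sqrt t₄.le
  have s₂' := (neg_sq √(critYSq d₂)).trans s₂
  have s₃' := (neg_sq √(critYSq d₃)).trans s₃
  have s₄' := (neg_sq √(critYSq d₄)).trans s₄
  have a₂ := critX_add_critYSq n₂
  have a₃ := critX_add_critYSq n₃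
  have a₄ := critX_add_critYSq n₄
  have hne : ∀ {d d' : ℝ}, 0 < critYSq d → 0 < critYSq d' → d + 2 ≠ 0 → d' + 2 ≠ 0 → d ≠ d' →
      (critX d, √(critYSq d)) ≠ (critX d', √(critYSq d')) := by
    intro d d' h h' hn hn' hdd he
    obtain ⟨e1, e2⟩ := Prod.mk.inj he
    have e3 : critYSq d = critYSq d' := by rw [← Real.sq_sqrt h.le, e2, Real.sq_sqrt h'.le]
    have := critX_add_critYSq hn
    have := critX_add_critYSq hn'
    exact hdd (by linarith)
  have hneg : ∀ {d y : ℝ}, d + 2 ≠ 0 → y ^ 2 = critYSq d → critQuartic ε d = 0 →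
      0 < d * (3 * d + 2) → critQuarticDeriv ε d < 0 → hessDet (f13 ε) (critX d, y) < 0 := by
    intro d y hn hy hr hm hD
    rw [hessDet_f13_of_root hn hy hr]
    exact div_neg_of_neg_of_pos (mul_neg_of_pos_of_neg hm hD) (by positivity)
  have hpos : ∀ {d y : ℝ}, d + 2 ≠ 0 → y ^ 2 = critYSq d → critQuartic ε d = 0 →
      0 < d * (3 * d + 2) → 0 < critQuarticDeriv ε d → 0 < hessDet (f13 ε) (critX d, y) := by
    intro d y hn hy hr hm hD
    rw [hessDet_f13_of_root hn hy hr]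
    positivity
  refine ⟨critX d₂, √(critYSq d₂), critX d₃, √(critYSq d₃), critX d₄, √(critYSq d₄),
    Real.sqrt_pos.2 t₂, Real.sqrt_pos.2 t₃, Real.sqrt_pos.2 t₄,
    hne t₂ t₃ n₂ n₃ (by linarith), hne t₂ t₄ n₂ n₄ (by linarith), hne t₃ t₄ n₃ n₄ (by linarith),
    ?_, by norm_num [hessDet_f13], by norm_num [hessDet_f13],
    hneg n₂ s₂ r₂ m₂ D₂, hneg n₂ s₂' r₂ m₂ D₂, hpos n₃ s₃ r₃ m₃ D₃, hpos n₃ s₃' r₃ m₃ D₃,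
    hneg n₄ s₄ r₄ m₄ D₄, hneg n₄ s₄' r₄ m₄ D₄, ?_⟩
  · rintro ⟨x, y⟩
    constructor
    · intro h
      by_cases hy : y = 0
      · subst hy
        obtain ⟨h, -⟩ := (isCriticalPt_f13_iff ε x 0).1 h
        have : (x - 1) * (x - 1 / 3) = 0 := by linear_combination h / 3
        rcases mul_eq_zero.1 this with h | h
        · left
          rw [sub_eq_zero.1 h]
        · right
          left
          rw [sub_eq_zero.1 h]
      · obtain ⟨d, hd, hr, rfl, hT⟩ := critQuartic_of_isCriticalPt hy h
        have hT0 : 0 < critYSq d := by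
          rw [← hT]
          positivity
        have hd2 : -2 < d := by
          by_contra! hlt
          have h1 : 0 < d * (3 * d + 2) := mul_pos_of_neg_of_neg (by linarith) (by linarith)
          have := pos_of_mul_pos_right ((critYSq_pos_iff hd).1 hT0) h1.le
          linarith
        have hy' : y = √(critYSq d) ∨ y = -√(critYSq d) := by
          rw [← sq_eq_sq_iff_eq_or_eq_neg, hT, Real.sq_sqrt hT0.le]
        rcases huniq d hd2 hr with rfl | rfl | rfl <;> rcases hy' with hy' | hy' <;> simp [← hy']
    · rintro (h | h | h | h | h | h | h | h) <;> rw [h]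
      · norm_num [isCriticalPt_f13_iff]
      · norm_num [isCriticalPt_f13_iff]
      · exact isCriticalPt_f13_of_root n₂ s₂ r₂
      · exact isCriticalPt_f13_of_root n₂ s₂' r₂
      · exact isCriticalPt_f13_of_root n₃ s₃ r₃
      · exact isCriticalPt_f13_of_root n₃ s₃' r₃
      · exact isCriticalPt_f13_of_root n₄ s₄ r₄
      · exact isCriticalPt_f13_of_root n₄ s₄' r₄
  · have hx : critX d₃ = (4 + 4 * d₃ - d₃ ^ 2) / (2 * (d₃ + 2)) := rfl
    have hx0 : 0 < critX d₃ := by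
      rw [hx]
      exact div_pos (by nlinarith) (by linarith)
    rw [s₃]
    linarith

/-- There exists `ε₀ > 0` such that for every `0 < ε < ε₀`, the polynomial
`x(x + (y−1)² − 2)(x + (y+1)² − 2) + εy⁶` has only nondegenerate critical points:
exactly eight of them, of which exactly two are local minima, exactly five are saddles,
and exactly one is a local maximum. -/
theorem morse_data_f13 :
    ∃ ε₀ : ℝ, 0 < ε₀ ∧ ∀ ε : ℝ, 0 < ε → ε < ε₀ →
      (∀ p : ℝ × ℝ, IsCriticalPt (f13 ε) p → hessDet (f13 ε) p ≠ 0) ∧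
      {p : ℝ × ℝ | IsCriticalPt (f13 ε) p}.Finite ∧
      {p : ℝ × ℝ | IsCriticalPt (f13 ε) p}.ncard = 8 ∧
      {p : ℝ × ℝ | IsCriticalPt (f13 ε) p ∧ IsLocMin (f13 ε) p}.ncard = 2 ∧
      {p : ℝ × ℝ | IsSaddle (f13 ε) p}.ncard = 5 ∧
      {p : ℝ × ℝ | IsCriticalPt (f13 ε) p ∧ IsLocMax (f13 ε) p}.ncard = 1 := by
  refine ⟨1 / 1000, by norm_num, fun ε h0 h1 => ?_⟩
  obtain ⟨x₂, y₂, x₃, y₃, x₄, y₄, p₂, p₃, p₄, n23, n24, n34, hcrit, H1, H0, H2, H2', H3, H3',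
    H4, H4', hxx⟩ := exists_critical_points h0 h1
  have c1 := (hcrit (1, 0)).2 (by simp)
  have c0 := (hcrit (1 / 3, 0)).2 (by simp)
  have c2 := (hcrit (x₂, y₂)).2 (by simp)
  have c2' := (hcrit (x₂, -y₂)).2 (by simp)
  have c3 := (hcrit (x₃, y₃)).2 (by simp)
  have c3' := (hcrit (x₃, -y₃)).2 (by simp)
  have c4 := (hcrit (x₄, y₄)).2 (by simp)
  have c4' := (hcrit (x₄, -y₄)).2 (by simp)
  have S1 := c1.f13_saddle H1
  have S0 := c0.f13_locMax H0 (by norm_num)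
  have S2 := c2.f13_saddle H2
  have S2' := c2'.f13_saddle H2'
  have S3 := c3.f13_locMin H3 hxx
  have S3' := c3'.f13_locMin H3' (by rwa [neg_sq])
  have S4 := c4.f13_saddle H4
  have S4' := c4'.f13_saddle H4'
  have e8 : {p : ℝ × ℝ | IsCriticalPt (f13 ε) p} =
      ↑({(1, 0), (1 / 3, 0), (x₂, y₂), (x₂, -y₂), (x₃, y₃), (x₃, -y₃), (x₄, y₄), (x₄, -y₄)} :
        Finset (ℝ × ℝ)) := by
    ext p
    simp only [Set.mem_ofPred_eq, hcrit, Finset.coe_insert, Finset.coe_singleton,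
      Set.mem_insert_iff, Set.mem_singleton_iff]
  have e2 : {p : ℝ × ℝ | IsCriticalPt (f13 ε) p ∧ IsLocMin (f13 ε) p} =
      ↑({(x₃, y₃), (x₃, -y₃)} : Finset (ℝ × ℝ)) := by
    ext p
    simp only [Set.mem_ofPred_eq, Finset.coe_insert, Finset.coe_singleton,
      Set.mem_insert_iff, Set.mem_singleton_iff]
    constructor
    · rintro ⟨h, hm⟩
      rcases (hcrit p).1 h with rfl | rfl | rfl | rfl | rfl | rfl | rfl | rfl <;> tauto
    · rintro (rfl | rfl) <;> tauto
  have e5 : {p : ℝ × ℝ | IsSaddle (f13 ε) p} =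
      ↑({(1, 0), (x₂, y₂), (x₂, -y₂), (x₄, y₄), (x₄, -y₄)} : Finset (ℝ × ℝ)) := by
    ext p
    simp only [Set.mem_ofPred_eq, IsSaddle, Finset.coe_insert, Finset.coe_singleton,
      Set.mem_insert_iff, Set.mem_singleton_iff]
    constructor
    · rintro ⟨h, hm⟩
      rcases (hcrit p).1 h with rfl | rfl | rfl | rfl | rfl | rfl | rfl | rfl <;> tauto
    · rintro (rfl | rfl | rfl | rfl | rfl) <;> tauto
  have e1 : {p : ℝ × ℝ | IsCriticalPt (f13 ε) p ∧ IsLocMax (f13 ε) p} =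
      ↑({(1 / 3, 0)} : Finset (ℝ × ℝ)) := by
    ext p
    simp only [Set.mem_ofPred_eq, Finset.coe_singleton, Set.mem_singleton_iff]
    constructor
    · rintro ⟨h, hm⟩
      rcases (hcrit p).1 h with rfl | rfl | rfl | rfl | rfl | rfl | rfl | rfl <;> tauto
    · rintro rfl
      tauto
  have q2 : y₂ ≠ -y₂ := by linarith
  have q3 : y₃ ≠ -y₃ := by linarith
  have q4 : y₄ ≠ -y₄ := by linarith
  have q23 : y₂ ≠ -y₃ := by linarith
  have q24 : y₂ ≠ -y₄ := by linarith
  have q34 : y₃ ≠ -y₄ := by linarith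
  have q32 : -y₂ ≠ y₃ := by linarith
  have q42 : -y₂ ≠ y₄ := by linarith
  have q43 : -y₃ ≠ y₄ := by linarith
  rw [Ne, Prod.mk.injEq] at n23 n24 n34
  refine ⟨?_, ?_, ?_, ?_, ?_, ?_⟩
  · intro p hp
    rcases (hcrit p).1 hp with rfl | rfl | rfl | rfl | rfl | rfl | rfl | rfl <;>
      first
      | exact ne_of_gt (by assumption)
      | exact ne_of_lt (by assumption)
  · rw [e8]
    exact Finset.finite_toSet _
  · rw [e8, Set.ncard_coe_finset]
    repeat rw [Finset.card_insert_of_notMem]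
    all_goals simp [p₂.ne, p₃.ne, p₄.ne, p₂.ne', p₃.ne', p₄.ne', q2, q3, q4, q23, q24,
      q34, q32, q42, q43, n23, n24, n34]
  · rw [e2, Set.ncard_coe_finset, Finset.card_pair]
    simp [q3]
  · rw [e5, Set.ncard_coe_finset]
    repeat rw [Finset.card_insert_of_notMem]
    all_goals simp [p₂.ne, p₄.ne, p₂.ne', p₄.ne', q2, q4, q24, q42, n24]
  · rw [e1, Set.ncard_coe_finset, Finset.card_singleton]
end

section
/- There exists ε₀ > 0 such that for every ε with 0 < ε < ε₀, the polynomial function f : ℝ² → ℝ given by f(x,y) = x·(x + (y−2)² − 2)·(x + (y+2)² − 2) + ε·y⁶ has only nondegenerate critical points, and it has exactly eight critical points, of which exactly three are local minima, exactly five are saddles, and none is a local maximum. -/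
/-- Realizing family for `J₁₀³` with eight critical points and no maxima. -/
noncomputable def f14 (ε : ℝ) : ℝ → ℝ → ℝ := fun x y =>
  x * (x + (y - 2) ^ 2 - 2) * (x + (y + 2) ^ 2 - 2) + ε * y ^ 6

open Filter Topology

section SecondOrder

variable {F a b c : ℝ × ℝ → ℝ} {p : ℝ × ℝ}

theorem isLocalMin_of_quadratic_expansion
    (hF : ∀ q, F q = F p + a q * (q.1 - p.1) ^ 2 + b q * (q.1 - p.1) * (q.2 - p.2)
      + c q * (q.2 - p.2) ^ 2)
    (ha : ContinuousAt a p) (hb : ContinuousAt b p) (hc : ContinuousAt c p)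
    (hpos : 0 < a p) (hdet : 0 < 4 * a p * c p - b p ^ 2) : IsLocalMin F p := by
  have h₁ : ∀ᶠ q in 𝓝 p, 0 < a q := ha.eventually (lt_mem_nhds hpos)
  have hd : ContinuousAt (fun q => 4 * a q * c q - b q ^ 2) p := by fun_prop
  have h₂ : ∀ᶠ q in 𝓝 p, 0 < 4 * a q * c q - b q ^ 2 := hd.eventually (lt_mem_nhds hdet)
  filter_upwards [h₁, h₂] with q hq₁ hq₂
  rw [hF q]
  generalize q.1 - p.1 = h
  generalize q.2 - p.2 = k
  have key : 0 ≤ 4 * a q * (a q * h ^ 2 + b q * h * k + c q * k ^ 2) := by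
    have : 4 * a q * (a q * h ^ 2 + b q * h * k + c q * k ^ 2)
        = (2 * a q * h + b q * k) ^ 2 + (4 * a q * c q - b q ^ 2) * k ^ 2 := by ring
    rw [this]
    positivity
  have := nonneg_of_mul_nonneg_right key (by positivity)
  linarith

theorem not_isLocalMin_of_quadratic_expansion
    (hF : ∀ q, F q = F p + a q * (q.1 - p.1) ^ 2 + b q * (q.1 - p.1) * (q.2 - p.2)
      + c q * (q.2 - p.2) ^ 2)
    (ha : ContinuousAt a p) (hb : ContinuousAt b p) (hc : ContinuousAt c p) (v w : ℝ)
    (hneg : a p * v ^ 2 + b p * v * w + c p * w ^ 2 < 0) : ¬ IsLocalMin F p := by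
  intro hmin
  have hQ : ContinuousAt (fun q => a q * v ^ 2 + b q * v * w + c q * w ^ 2) p := by fun_prop
  have hev : ∀ᶠ q in 𝓝 p, a q * v ^ 2 + b q * v * w + c q * w ^ 2 < 0 ∧ F p ≤ F q :=
    (hQ.eventually (gt_mem_nhds hneg)).and hmin
  have hline : Tendsto (fun t : ℝ => (p.1 + t * v, p.2 + t * w)) (𝓝[≠] 0) (𝓝 p) := by
    have : Continuous (fun t : ℝ => (p.1 + t * v, p.2 + t * w)) := by fun_prop
    simpa using (this.tendsto 0).mono_left nhdsWithin_le_nhds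
  obtain ⟨t, ⟨ht, hle⟩, ht₀⟩ := ((hline.eventually hev).and self_mem_nhdsWithin).exists
  rw [hF (p.1 + t * v, p.2 + t * w)] at hle
  have ht₂ : 0 < t ^ 2 := by
    have : t ≠ 0 := ht₀
    positivity
  nlinarith [mul_neg_of_pos_of_neg ht₂ ht]

theorem not_isLocalMax_of_quadratic_expansion
    (hF : ∀ q, F q = F p + a q * (q.1 - p.1) ^ 2 + b q * (q.1 - p.1) * (q.2 - p.2)
      + c q * (q.2 - p.2) ^ 2)
    (ha : ContinuousAt a p) (hb : ContinuousAt b p) (hc : ContinuousAt c p) (v w : ℝ)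
    (hpos : 0 < a p * v ^ 2 + b p * v * w + c p * w ^ 2) : ¬ IsLocalMax F p := by
  intro hmax
  refine not_isLocalMin_of_quadratic_expansion (F := fun q => -F q) (a := fun q => -a q)
    (b := fun q => -b q) (c := fun q => -c q) (fun q => ?_) ha.neg hb.neg hc.neg v w ?_ hmax.neg
  · rw [hF q]
    ring
  · linarith

end SecondOrder

/-- Vieta's formulas for a quartic with four distinct known roots. -/
theorem quartic_vieta {c₀ c₁ c₂ c₃ c₄ r₀ r₁ r₂ r₃ : ℝ}
    (h₀ : c₄ * r₀ ^ 4 + c₃ * r₀ ^ 3 + c₂ * r₀ ^ 2 + c₁ * r₀ + c₀ = 0)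
    (h₁ : c₄ * r₁ ^ 4 + c₃ * r₁ ^ 3 + c₂ * r₁ ^ 2 + c₁ * r₁ + c₀ = 0)
    (h₂ : c₄ * r₂ ^ 4 + c₃ * r₂ ^ 3 + c₂ * r₂ ^ 2 + c₁ * r₂ + c₀ = 0)
    (h₃ : c₄ * r₃ ^ 4 + c₃ * r₃ ^ 3 + c₂ * r₃ ^ 2 + c₁ * r₃ + c₀ = 0)
    (h₀₁ : r₀ < r₁) (h₁₂ : r₁ < r₂) (h₂₃ : r₂ < r₃) :
    c₃ = -c₄ * (r₀ + r₁ + r₂ + r₃) ∧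
    c₂ = c₄ * (r₀ * r₁ + r₀ * r₂ + r₀ * r₃ + r₁ * r₂ + r₁ * r₃ + r₂ * r₃) ∧
    c₁ = -c₄ * (r₀ * r₁ * r₂ + r₀ * r₁ * r₃ + r₀ * r₂ * r₃ + r₁ * r₂ * r₃) ∧
    c₀ = c₄ * (r₀ * r₁ * r₂ * r₃) := by
  have d₁ : ∀ {x y : ℝ}, x < y →
      c₄ * x ^ 4 + c₃ * x ^ 3 + c₂ * x ^ 2 + c₁ * x + c₀ = 0 →
      c₄ * y ^ 4 + c₃ * y ^ 3 + c₂ * y ^ 2 + c₁ * y + c₀ = 0 →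
      c₄ * (x ^ 3 + x ^ 2 * y + x * y ^ 2 + y ^ 3) + c₃ * (x ^ 2 + x * y + y ^ 2)
        + c₂ * (x + y) + c₁ = 0 := fun {x y} hxy hx hy =>
    mul_left_cancel₀ (sub_pos.2 hxy).ne' (by linear_combination hy - hx)
  have d₂ : ∀ {x y z : ℝ}, x < z →
      c₄ * (x ^ 3 + x ^ 2 * y + x * y ^ 2 + y ^ 3) + c₃ * (x ^ 2 + x * y + y ^ 2)
        + c₂ * (x + y) + c₁ = 0 →
      c₄ * (y ^ 3 + y ^ 2 * z + y * z ^ 2 + z ^ 3) + c₃ * (y ^ 2 + y * z + z ^ 2)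
        + c₂ * (y + z) + c₁ = 0 →
      c₄ * (x ^ 2 + y ^ 2 + z ^ 2 + x * y + x * z + y * z) + c₃ * (x + y + z) + c₂ = 0 :=
    fun {x y z} hxz hxy hyz =>
      mul_left_cancel₀ (sub_pos.2 hxz).ne' (by linear_combination hyz - hxy)
  have e₀₁ := d₁ h₀₁ h₀ h₁
  have e₁₂ := d₁ h₁₂ h₁ h₂
  have e₂₃ := d₁ h₂₃ h₂ h₃
  have e₀₁₂ := d₂ (h₀₁.trans h₁₂) e₀₁ e₁₂
  have e₁₂₃ := d₂ (h₁₂.trans h₂₃) e₁₂ e₂₃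
  have hc₃ : c₃ = -c₄ * (r₀ + r₁ + r₂ + r₃) :=
    mul_left_cancel₀ (sub_pos.2 (h₀₁.trans (h₁₂.trans h₂₃))).ne'
      (by linear_combination e₁₂₃ - e₀₁₂)
  have hc₂ : c₂ = c₄ * (r₀ * r₁ + r₀ * r₂ + r₀ * r₃ + r₁ * r₂ + r₁ * r₃ + r₂ * r₃) := by
    linear_combination e₀₁₂ - (r₀ + r₁ + r₂) * hc₃
  have hc₁ : c₁ = -c₄ * (r₀ * r₁ * r₂ + r₀ * r₁ * r₃ + r₀ * r₂ * r₃ + r₁ * r₂ * r₃) := by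
    linear_combination e₀₁ - (r₀ ^ 2 + r₀ * r₁ + r₁ ^ 2) * hc₃ - (r₀ + r₁) * hc₂
  exact ⟨hc₃, hc₂, hc₁, by
    linear_combination h₀ - r₀ ^ 3 * hc₃ - r₀ ^ 2 * hc₂ - r₀ * hc₁⟩

/-- The function `f14 ε` in terms of `x` and `s = y ^ 2`. -/
theorem f14_eq (ε x y : ℝ) :
    f14 ε x y = x ^ 3 + 2 * x ^ 2 * (y ^ 2 + 2) + x * (y ^ 4 - 12 * y ^ 2 + 4) + ε * y ^ 6 := by
  unfold f14
  ring

theorem deriv_f14_fst (ε x y : ℝ) :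
    deriv (fun t => f14 ε t y) x
      = 3 * x ^ 2 + 4 * x * (y ^ 2 + 2) + (y ^ 4 - 12 * y ^ 2 + 4) := by
  simp only [f14_eq]
  have h := hasDerivAt_id' x
  refine HasDerivAt.deriv <| (((((h.pow 3).add (((h.pow 2).const_mul 2).mul_const (y ^ 2 + 2))).add
    (h.mul_const (y ^ 4 - 12 * y ^ 2 + 4))).add_const (ε * y ^ 6))).congr_deriv ?_
  push_cast
  ring

theorem deriv_f14_snd (ε x y : ℝ) :
    deriv (fun t => f14 ε x t) y
      = 2 * y * (2 * x ^ 2 + 2 * x * y ^ 2 - 12 * x + 3 * ε * y ^ 4) := by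
  simp only [f14_eq]
  have h := hasDerivAt_id' y
  refine HasDerivAt.deriv <| ((((((h.pow 2).add_const 2).const_mul (2 * x ^ 2)).const_add
    (x ^ 3)).add ((((h.pow 4).sub ((h.pow 2).const_mul 12)).add_const 4).const_mul x)).add
    ((h.pow 6).const_mul ε)).congr_deriv ?_
  push_cast
  ring

theorem isCriticalPt_f14 {ε x y : ℝ} :
    IsCriticalPt (f14 ε) (x, y) ↔
      3 * x ^ 2 + 4 * x * (y ^ 2 + 2) + (y ^ 4 - 12 * y ^ 2 + 4) = 0 ∧
      2 * y * (2 * x ^ 2 + 2 * x * y ^ 2 - 12 * x + 3 * ε * y ^ 4) = 0 := by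
  simp only [IsCriticalPt, deriv_f14_fst, deriv_f14_snd]

theorem hessDet_f14 (ε x y : ℝ) :
    hessDet (f14 ε) (x, y)
      = (6 * x + 4 * (y ^ 2 + 2)) * (4 * x ^ 2 + 12 * x * y ^ 2 - 24 * x + 30 * ε * y ^ 4)
        - (8 * x * y + 4 * y ^ 3 - 24 * y) ^ 2 := by
  simp only [hessDet, deriv_f14_fst, deriv_f14_snd]
  have hx := hasDerivAt_id' x
  have hy := hasDerivAt_id' y
  congr 1
  · congr 1
    · refine HasDerivAt.deriv <| ((((hx.pow 2).const_mul 3).add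
        ((hx.const_mul 4).mul_const (y ^ 2 + 2))).add_const
          (y ^ 4 - 12 * y ^ 2 + 4)).congr_deriv ?_
      push_cast
      ring
    · refine HasDerivAt.deriv <| ((hy.const_mul 2).mul (((((hy.pow 2).const_mul (2 * x)).const_add
        (2 * x ^ 2)).sub_const (12 * x)).add ((hy.pow 4).const_mul (3 * ε)))).congr_deriv ?_
      simp only [Pi.add_apply, Pi.pow_apply]
      push_cast
      ring
  · congr 1
    refine HasDerivAt.deriv <| ((((hy.pow 2).add_const 2).const_mul (4 * x)).const_add
      (3 * x ^ 2)).add (((hy.pow 4).sub ((hy.pow 2).const_mul 12)).add_const 4) |>.congr_deriv ?_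
    push_cast
    ring

/-- Second order expansion of `f14 ε` at a critical point, with continuous coefficients. -/
theorem f14_expansion {ε x y : ℝ} (h : IsCriticalPt (f14 ε) (x, y)) :
    ∃ a b c : ℝ × ℝ → ℝ, Continuous a ∧ Continuous b ∧ Continuous c ∧
      a (x, y) = 3 * x + 2 * (y ^ 2 + 2) ∧
      b (x, y) = 8 * x * y + 4 * y ^ 3 - 24 * y ∧
      c (x, y) = 2 * x ^ 2 + 6 * x * y ^ 2 - 12 * x + 15 * ε * y ^ 4 ∧
      ∀ q : ℝ × ℝ, f14 ε q.1 q.2 = f14 ε x y + a q * (q.1 - x) ^ 2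
        + b q * (q.1 - x) * (q.2 - y) + c q * (q.2 - y) ^ 2 := by
  rw [isCriticalPt_f14] at h
  refine ⟨fun q => 3 * x + 2 * (y ^ 2 + 2) + (q.1 - x) + 2 * (q.2 ^ 2 - y ^ 2),
    fun q => (q.2 + y) * (4 * x + 2 * y ^ 2 - 12 + (q.2 ^ 2 - y ^ 2)),
    fun q => 2 * x ^ 2 + 2 * x * y ^ 2 - 12 * x + 3 * ε * y ^ 4
      + (q.2 + y) ^ 2 * (x + 3 * ε * y ^ 2 + ε * (q.2 ^ 2 - y ^ 2)),
    by fun_prop, by fun_prop, by fun_prop, by ring, by ring, by ring, fun q => ?_⟩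
  simp only [f14_eq]
  linear_combination (q.1 - x) * h.1 + (q.2 - y) * h.2

theorem isLocMin_f14 {ε x y : ℝ} (h : IsCriticalPt (f14 ε) (x, y))
    (hxx : 0 < 3 * x + 2 * (y ^ 2 + 2)) (hdet : 0 < hessDet (f14 ε) (x, y)) :
    IsLocMin (f14 ε) (x, y) := by
  obtain ⟨a, b, c, ha, hb, hc, ha₀, hb₀, hc₀, hF⟩ := f14_expansion h
  refine isLocalMin_of_quadratic_expansion hF ha.continuousAt hb.continuousAt hc.continuousAt
    (ha₀ ▸ hxx) ?_
  rw [hessDet_f14] at hdet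
  rw [ha₀, hb₀, hc₀]
  linarith

theorem not_isLocMax_f14 {ε x y : ℝ} (h : IsCriticalPt (f14 ε) (x, y))
    (hxx : 0 < 3 * x + 2 * (y ^ 2 + 2)) : ¬ IsLocMax (f14 ε) (x, y) := by
  obtain ⟨a, b, c, ha, hb, hc, ha₀, hb₀, hc₀, hF⟩ := f14_expansion h
  refine not_isLocalMax_of_quadratic_expansion hF ha.continuousAt hb.continuousAt
    hc.continuousAt 1 0 ?_
  rw [ha₀]
  linarith

theorem not_isLocMin_f14 {ε x y : ℝ} (h : IsCriticalPt (f14 ε) (x, y))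
    (hxx : 0 < 3 * x + 2 * (y ^ 2 + 2)) (hdet : hessDet (f14 ε) (x, y) < 0) :
    ¬ IsLocMin (f14 ε) (x, y) := by
  obtain ⟨a, b, c, ha, hb, hc, ha₀, hb₀, hc₀, hF⟩ := f14_expansion h
  refine not_isLocalMin_of_quadratic_expansion hF ha.continuousAt hb.continuousAt
    hc.continuousAt (-b (x, y)) (2 * a (x, y)) ?_
  rw [hessDet_f14] at hdet
  have hapos : 0 < a (x, y) := ha₀ ▸ hxx
  have hd : 4 * a (x, y) * c (x, y) - b (x, y) ^ 2 < 0 := by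
    rw [ha₀, hb₀, hc₀]
    linarith
  nlinarith [mul_neg_of_pos_of_neg hapos hd]

theorem isCriticalPt_f14_axis {ε x : ℝ} :
    IsCriticalPt (f14 ε) (x, 0) ↔ x = -2 ∨ x = -2 / 3 := by
  rw [isCriticalPt_f14]
  constructor
  · rintro ⟨h, -⟩
    have : (x + 2) * (3 * x + 2) = 0 := by linear_combination h
    rcases mul_eq_zero.1 this with h | h
    · exact .inl (by linarith)
    · exact .inr (by linarith)
  · rintro (rfl | rfl) <;> norm_num

theorem isSaddle_f14_axis (ε : ℝ) : IsSaddle (f14 ε) (-2, 0) := by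
  have h : IsCriticalPt (f14 ε) (-2, 0) := isCriticalPt_f14_axis.2 (.inl rfl)
  obtain ⟨a, b, c, ha, hb, hc, ha₀, hb₀, hc₀, hF⟩ := f14_expansion h
  refine ⟨h, not_isLocalMin_of_quadratic_expansion hF ha.continuousAt hb.continuousAt
    hc.continuousAt 1 0 ?_, not_isLocalMax_of_quadratic_expansion hF ha.continuousAt
    hb.continuousAt hc.continuousAt 0 1 ?_⟩
  · rw [ha₀]
    norm_num
  · rw [hc₀]
    norm_num

/-- The off-axis critical points of `f14 ε` are parametrized by the roots of this quartic in
`u = x + y ^ 2 + 2`. -/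
def f14Quartic (ε u : ℝ) : ℝ :=
  4 * (u ^ 2 - 16 * u + 32) * (u ^ 2 - 64) - 3 * ε * u ^ 2 * (3 * u - 4) ^ 2

theorem continuous_f14Quartic (ε : ℝ) : Continuous (f14Quartic ε) := by
  unfold f14Quartic
  fun_prop

theorem f14Quartic_eq (ε u : ℝ) :
    f14Quartic ε u = (4 - 27 * ε) * u ^ 4 + (-64 + 72 * ε) * u ^ 3 + (-128 - 48 * ε) * u ^ 2
      + 4096 * u + -8192 := by
  unfold f14Quartic
  ring

/-- The derivative of `f14Quartic ε`. -/
def f14QuarticDeriv (ε u : ℝ) : ℝ :=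
  4 * (4 - 27 * ε) * u ^ 3 + 3 * (-64 + 72 * ε) * u ^ 2 + 2 * (-128 - 48 * ε) * u + 4096

theorem exists_f14Quartic_roots {ε : ℝ} (hε : 0 < ε) (hε' : ε < 1 / 100) :
    ∃ r₁ r₂ r₃ : ℝ, 4 / 3 < r₁ ∧ r₁ < r₂ ∧ r₂ < r₃ ∧
      f14Quartic ε r₁ = 0 ∧ f14Quartic ε r₂ = 0 ∧ f14Quartic ε r₃ = 0 ∧
      (∀ u, 4 / 3 < u → f14Quartic ε u = 0 → u = r₁ ∨ u = r₂ ∨ u = r₃) ∧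
      0 < f14QuarticDeriv ε r₁ ∧ f14QuarticDeriv ε r₂ < 0 ∧ 0 < f14QuarticDeriv ε r₃ := by
  have hcont {s : Set ℝ} := (continuous_f14Quartic ε).continuousOn (s := s)
  have v₀ : 0 < f14Quartic ε (-20) := by unfold f14Quartic; linarith
  have v₁ : f14Quartic ε (-8) < 0 := by unfold f14Quartic; linarith
  have v₂ : f14Quartic ε (4 / 3) < 0 := by unfold f14Quartic; linarith
  have v₃ : 0 < f14Quartic ε 5 := by unfold f14Quartic; linarith
  have v₄ : f14Quartic ε 10 < 0 := by unfold f14Quartic; linarith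
  have v₅ : 0 < f14Quartic ε 20 := by unfold f14Quartic; linarith
  obtain ⟨r₀, ⟨-, hr₀⟩, e₀⟩ := intermediate_value_Ioo' (by norm_num) hcont ⟨v₁, v₀⟩
  obtain ⟨r₁, ⟨hr₁, hr₁'⟩, e₁⟩ := intermediate_value_Ioo (by norm_num) hcont ⟨v₂, v₃⟩
  obtain ⟨r₂, ⟨hr₂, hr₂'⟩, e₂⟩ := intermediate_value_Ioo' (by norm_num) hcont ⟨v₄, v₃⟩
  obtain ⟨r₃, ⟨hr₃, -⟩, e₃⟩ := intermediate_value_Ioo (by norm_num) hcont ⟨v₄, v₅⟩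
  have h₀₁ : r₀ < r₁ := by linarith
  have h₁₂ : r₁ < r₂ := by linarith
  have h₂₃ : r₂ < r₃ := by linarith
  obtain ⟨hc₃, hc₂, hc₁, hc₀⟩ := quartic_vieta (f14Quartic_eq ε r₀ ▸ e₀) (f14Quartic_eq ε r₁ ▸ e₁)
    (f14Quartic_eq ε r₂ ▸ e₂) (f14Quartic_eq ε r₃ ▸ e₃) h₀₁ h₁₂ h₂₃
  have hlead : 0 < 4 - 27 * ε := by linarith
  have hprod (u : ℝ) :
      f14Quartic ε u = (4 - 27 * ε) * (u - r₀) * (u - r₁) * (u - r₂) * (u - r₃) := by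
    rw [f14Quartic_eq]
    linear_combination u ^ 3 * hc₃ + u ^ 2 * hc₂ + u * hc₁ + hc₀
  have hderiv (u : ℝ) : f14QuarticDeriv ε u = (4 - 27 * ε) *
      ((u - r₁) * (u - r₂) * (u - r₃) + (u - r₀) * (u - r₂) * (u - r₃)
        + (u - r₀) * (u - r₁) * (u - r₃) + (u - r₀) * (u - r₁) * (u - r₂)) := by
    unfold f14QuarticDeriv
    linear_combination 3 * u ^ 2 * hc₃ + 2 * u * hc₂ + hc₁
  have p₀₁ := sub_pos.2 h₀₁
  have p₁₂ := sub_pos.2 h₁₂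
  have p₂₃ := sub_pos.2 h₂₃
  have p₀₂ := sub_pos.2 (h₀₁.trans h₁₂)
  have p₁₃ := sub_pos.2 (h₁₂.trans h₂₃)
  have p₀₃ := sub_pos.2 (h₀₁.trans (h₁₂.trans h₂₃))
  refine ⟨r₁, r₂, r₃, hr₁, h₁₂, h₂₃, e₁, e₂, e₃, fun u hu hPu => ?_, ?_, ?_, ?_⟩
  · have hur₀ : u - r₀ ≠ 0 := by linarith
    simpa [hprod, hlead.ne', hur₀, sub_eq_zero, or_assoc] using hPu
  · have : 0 < (4 - 27 * ε) * ((r₁ - r₀) * (r₂ - r₁) * (r₃ - r₁)) := by positivity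
    rw [hderiv]
    linarith
  · have : 0 < (4 - 27 * ε) * ((r₂ - r₀) * (r₂ - r₁) * (r₃ - r₂)) := by positivity
    rw [hderiv]
    linarith
  · have : 0 < (4 - 27 * ε) * ((r₃ - r₀) * (r₃ - r₁) * (r₃ - r₂)) := by positivity
    rw [hderiv]
    linarith

theorem exists_crit_of_root {ε u : ℝ} (hu : 4 / 3 < u) (hP : f14Quartic ε u = 0) :
    ∃ x y : ℝ, 0 < y ∧ x + y ^ 2 + 2 = u ∧ IsCriticalPt (f14 ε) (x, y) := by
  have hw : 0 < u + 8 := by linarith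
  have hS : 0 < u * (3 * u - 4) / (2 * (u + 8)) := by
    have h₁ : 0 < u := by linarith
    have h₂ : 0 < 3 * u - 4 := by linarith
    positivity
  have hsq := Real.sq_sqrt hS.le
  have hq : √(u * (3 * u - 4) / (2 * (u + 8))) ^ 4 = (u * (3 * u - 4) / (2 * (u + 8))) ^ 2 := by
    rw [← hsq]
    simp only [Real.sqrt_sq_eq_abs, abs_of_pos (Real.sqrt_pos.2 hS)]
    ring
  refine ⟨-(u ^ 2 - 16 * u + 32) / (2 * (u + 8)), √(u * (3 * u - 4) / (2 * (u + 8))),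
    Real.sqrt_pos.2 hS, ?_, isCriticalPt_f14.2 ⟨?_, mul_eq_zero_of_right _ ?_⟩⟩
  · rw [hsq]
    field_simp
    ring
  · rw [hq, hsq]
    field_simp
    ring
  · unfold f14Quartic at hP
    rw [hq, hsq]
    field_simp
    linear_combination -hP

section OffAxis

variable {ε x y : ℝ}

theorem crit_mul_x (h : IsCriticalPt (f14 ε) (x, y)) :
    2 * x * (x + y ^ 2 + 2 + 8)
      = -((x + y ^ 2 + 2) ^ 2 - 16 * (x + y ^ 2 + 2) + 32) := by
  linear_combination (isCriticalPt_f14.1 h).1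

theorem crit_mul_sq (h : IsCriticalPt (f14 ε) (x, y)) :
    2 * y ^ 2 * (x + y ^ 2 + 2 + 8) = (x + y ^ 2 + 2) * (3 * (x + y ^ 2 + 2) - 4) := by
  linear_combination -(isCriticalPt_f14.1 h).1

theorem root_of_crit (h : IsCriticalPt (f14 ε) (x, y)) (hy : y ≠ 0) :
    f14Quartic ε (x + y ^ 2 + 2) = 0 := by
  have hx := crit_mul_x h
  have hs := crit_mul_sq h
  have hF : 2 * x * (x + y ^ 2 + 2 - 8) + 3 * ε * (y ^ 2) ^ 2 = 0 := by
    have := (mul_eq_zero.1 (isCriticalPt_f14.1 h).2).resolve_left (by simpa using hy)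
    linear_combination this
  generalize x + y ^ 2 + 2 = u at *
  generalize y ^ 2 = s at *
  unfold f14Quartic
  linear_combination -4 * (u + 8) ^ 2 * hF + 4 * (u - 8) * (u + 8) * hx
    + 3 * ε * (2 * s * (u + 8) + u * (3 * u - 4)) * hs

theorem crit_lt (hε : 0 < ε) (h : IsCriticalPt (f14 ε) (x, y)) (hy : y ≠ 0) :
    4 / 3 < x + y ^ 2 + 2 := by
  have hs := crit_mul_sq h
  have hP := root_of_crit h hy
  have hs₀ : 0 < y ^ 2 := by positivity
  generalize x + y ^ 2 + 2 = u at *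
  generalize y ^ 2 = s at *
  by_contra! hu
  have hu₈ : -8 < u := by
    by_contra! h₈
    nlinarith
  have hu₀ : u < 0 := by
    by_contra! h₀
    nlinarith
  have h₁ : 4 * (u ^ 2 - 16 * u + 32) * (u ^ 2 - 64) < 0 :=
    mul_neg_of_pos_of_neg (by nlinarith) (by nlinarith)
  have h₂ : 0 ≤ 3 * ε * u ^ 2 * (3 * u - 4) ^ 2 := by positivity
  unfold f14Quartic at hP
  linarith

theorem fst_second_deriv_pos (h : IsCriticalPt (f14 ε) (x, y))
    (hu : 4 / 3 < x + y ^ 2 + 2) : 0 < 3 * x + 2 * (y ^ 2 + 2) := by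
  have hx := crit_mul_x h
  have : 3 * x + 2 * (y ^ 2 + 2) = 2 * (x + y ^ 2 + 2) + x := by ring
  rw [this]
  generalize x + y ^ 2 + 2 = u at *
  by_contra! hneg
  nlinarith

theorem hessDet_mul_of_crit (h : IsCriticalPt (f14 ε) (x, y)) (hy : y ≠ 0)
    (hu : 4 / 3 < x + y ^ 2 + 2) :
    hessDet (f14 ε) (x, y) * (x + y ^ 2 + 2 + 8) =
      -(2 * y ^ 2) * f14QuarticDeriv ε (x + y ^ 2 + 2) := by
  have hP := root_of_crit h hy
  have hx := crit_mul_x h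
  have hs := crit_mul_sq h
  have hF := (mul_eq_zero.1 (isCriticalPt_f14.1 h).2).resolve_left (by simpa using hy)
  have hH : hessDet (f14 ε) (x, y) = 4 * y ^ 2 * ((4 * (x + y ^ 2 + 2) + 2 * x)
      * (2 * x + 6 * ε * y ^ 2) - (2 * (x + y ^ 2 + 2) + 2 * x - 16) ^ 2) := by
    rw [hessDet_f14]
    linear_combination 2 * (6 * x + 4 * (y ^ 2 + 2)) * hF
  rw [hH]
  generalize x + y ^ 2 + 2 = u at *
  have hw : u + 8 ≠ 0 := by linarith
  have hx' : x = -(u ^ 2 - 16 * u + 32) / (2 * (u + 8)) := by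
    field_simp
    linear_combination hx
  have hs' : y ^ 2 = u * (3 * u - 4) / (2 * (u + 8)) := by
    field_simp
    linear_combination hs
  unfold f14Quartic at hP
  unfold f14QuarticDeriv
  rw [hx', hs']
  field_simp
  linear_combination 8 * (3 * u - 4) * hP

theorem hessDet_neg_of_crit (h : IsCriticalPt (f14 ε) (x, y)) (hy : y ≠ 0)
    (hu : 4 / 3 < x + y ^ 2 + 2) (hd : 0 < f14QuarticDeriv ε (x + y ^ 2 + 2)) :
    hessDet (f14 ε) (x, y) < 0 := by
  have key := hessDet_mul_of_crit h hy hu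
  have : 0 < 2 * y ^ 2 * f14QuarticDeriv ε (x + y ^ 2 + 2) := by positivity
  refine neg_of_mul_neg_left (b := x + y ^ 2 + 2 + 8) ?_ (by linarith)
  linarith

theorem hessDet_pos_of_crit (h : IsCriticalPt (f14 ε) (x, y)) (hy : y ≠ 0)
    (hu : 4 / 3 < x + y ^ 2 + 2) (hd : f14QuarticDeriv ε (x + y ^ 2 + 2) < 0) :
    0 < hessDet (f14 ε) (x, y) := by
  have key := hessDet_mul_of_crit h hy hu
  have : 2 * y ^ 2 * f14QuarticDeriv ε (x + y ^ 2 + 2) < 0 :=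
    mul_neg_of_pos_of_neg (by positivity) hd
  refine pos_of_mul_pos_left (b := x + y ^ 2 + 2 + 8) ?_ (by linarith)
  linarith

theorem crit_neg_snd (h : IsCriticalPt (f14 ε) (x, y)) : IsCriticalPt (f14 ε) (x, -y) := by
  rw [isCriticalPt_f14] at h ⊢
  exact ⟨by linear_combination h.1, by linear_combination -h.2⟩

theorem crit_eq_or_eq {x' y' : ℝ} (h : IsCriticalPt (f14 ε) (x, y))
    (h' : IsCriticalPt (f14 ε) (x', y')) (hu : 4 / 3 < x + y ^ 2 + 2)
    (heq : x + y ^ 2 + 2 = x' + y' ^ 2 + 2) :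
    (x, y) = (x', y') ∨ (x, y) = (x', -y') := by
  have hx := crit_mul_x h
  have hx' := crit_mul_x h'
  rw [← heq] at hx'
  have hw : x + y ^ 2 + 2 + 8 ≠ 0 := by linarith
  have hxx : x = x' := mul_right_cancel₀ hw (by linear_combination (hx - hx') / 2)
  subst hxx
  rcases sq_eq_sq_iff_eq_or_eq_neg.1 (show y ^ 2 = y' ^ 2 by linarith) with rfl | rfl <;> simp

end OffAxis

/-- There exists `ε₀ > 0` such that for every `0 < ε < ε₀`, the polynomial
`x(x + (y−2)² − 2)(x + (y+2)² − 2) + εy⁶` has only nondegenerate critical points: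
exactly eight of them, of which exactly three are local minima, exactly five are
saddles, and none is a local maximum. -/
theorem morse_data_f14 :
    ∃ ε₀ : ℝ, 0 < ε₀ ∧ ∀ ε : ℝ, 0 < ε → ε < ε₀ →
      (∀ p : ℝ × ℝ, IsCriticalPt (f14 ε) p → hessDet (f14 ε) p ≠ 0) ∧
      {p : ℝ × ℝ | IsCriticalPt (f14 ε) p}.Finite ∧
      {p : ℝ × ℝ | IsCriticalPt (f14 ε) p}.ncard = 8 ∧
      {p : ℝ × ℝ | IsCriticalPt (f14 ε) p ∧ IsLocMin (f14 ε) p}.ncard = 3 ∧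
      {p : ℝ × ℝ | IsSaddle (f14 ε) p}.ncard = 5 ∧
      (∀ p : ℝ × ℝ, IsCriticalPt (f14 ε) p → ¬ IsLocMax (f14 ε) p) := by
  refine ⟨1 / 100, by norm_num, fun ε hε hε' => ?_⟩
  obtain ⟨r₁, r₂, r₃, hr₁, h₁₂, h₂₃, e₁, e₂, e₃, huniq, hd₁, hd₂, hd₃⟩ :=
    exists_f14Quartic_roots hε hε'
  have hr₂ := hr₁.trans h₁₂
  have hr₃ := hr₂.trans h₂₃
  obtain ⟨x₁, y₁, hy₁, rfl, k₁⟩ := exists_crit_of_root hr₁ e₁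
  obtain ⟨x₂, y₂, hy₂, rfl, k₂⟩ := exists_crit_of_root hr₂ e₂
  obtain ⟨x₃, y₃, hy₃, rfl, k₃⟩ := exists_crit_of_root hr₃ e₃
  have saddle {x y : ℝ} (h : IsCriticalPt (f14 ε) (x, y)) (hy : y ≠ 0)
      (hu : 4 / 3 < x + y ^ 2 + 2) (hd : 0 < f14QuarticDeriv ε (x + y ^ 2 + 2)) :
      IsSaddle (f14 ε) (x, y) ∧ hessDet (f14 ε) (x, y) ≠ 0 :=
    have hxx := fst_second_deriv_pos h hu
    have hdet := hessDet_neg_of_crit h hy hu hd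
    ⟨⟨h, not_isLocMin_f14 h hxx hdet, not_isLocMax_f14 h hxx⟩, hdet.ne⟩
  have minimum {x y : ℝ} (h : IsCriticalPt (f14 ε) (x, y)) (hxx : 0 < 3 * x + 2 * (y ^ 2 + 2))
      (hdet : 0 < hessDet (f14 ε) (x, y)) : (IsCriticalPt (f14 ε) (x, y) ∧
        IsLocMin (f14 ε) (x, y)) ∧ ¬ IsLocMax (f14 ε) (x, y) ∧ hessDet (f14 ε) (x, y) ≠ 0 :=
    ⟨⟨h, isLocMin_f14 h hxx hdet⟩, not_isLocMax_f14 h hxx, hdet.ne'⟩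
  have a₁ := isSaddle_f14_axis ε
  have a₁' : hessDet (f14 ε) (-2, 0) ≠ 0 := by
    rw [hessDet_f14]
    norm_num
  have a₂ := minimum (x := -2 / 3) (y := 0) (isCriticalPt_f14_axis.2 (.inr rfl)) (by norm_num)
    (by rw [hessDet_f14]; norm_num)
  have s₁ := saddle k₁ hy₁.ne' hr₁ hd₁
  have s₁' := saddle (crit_neg_snd k₁) (neg_ne_zero.2 hy₁.ne') (by rwa [neg_sq]) (by rwa [neg_sq])
  have s₃ := saddle k₃ hy₃.ne' hr₃ hd₃
  have s₃' := saddle (crit_neg_snd k₃) (neg_ne_zero.2 hy₃.ne') (by rwa [neg_sq]) (by rwa [neg_sq])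
  have m₂ := minimum k₂ (fst_second_deriv_pos k₂ hr₂) (hessDet_pos_of_crit k₂ hy₂.ne' hr₂ hd₂)
  have k₂' := crit_neg_snd k₂
  have hr₂' : 4 / 3 < x₂ + (-y₂) ^ 2 + 2 := by rwa [neg_sq]
  have m₂' := minimum k₂' (fst_second_deriv_pos k₂' hr₂')
    (hessDet_pos_of_crit k₂' (neg_ne_zero.2 hy₂.ne') hr₂' (by rwa [neg_sq]))
  have hcover {p : ℝ × ℝ} (h : IsCriticalPt (f14 ε) p) :
      p = (-2, 0) ∨ p = (-2 / 3, 0) ∨ p = (x₁, y₁) ∨ p = (x₁, -y₁) ∨ p = (x₂, y₂) ∨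
        p = (x₂, -y₂) ∨ p = (x₃, y₃) ∨ p = (x₃, -y₃) := by
    obtain ⟨x, y⟩ := p
    by_cases hy : y = 0
    · subst hy
      rcases isCriticalPt_f14_axis.1 h with rfl | rfl <;> simp
    · have hu := crit_lt hε h hy
      rcases huniq _ hu (root_of_crit h hy) with heq | heq | heq
      · have := crit_eq_or_eq h k₁ hu heq
        tauto
      · have := crit_eq_or_eq h k₂ hu heq
        tauto
      · have := crit_eq_or_eq h k₃ hu heq
        tauto
  have hcrit : {p : ℝ × ℝ | IsCriticalPt (f14 ε) p} =
      {(-2, 0), (-2 / 3, 0), (x₁, y₁), (x₁, -y₁), (x₂, y₂), (x₂, -y₂), (x₃, y₃), (x₃, -y₃)} := by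
    ext p
    refine ⟨fun h => by simpa using hcover h, ?_⟩
    rintro (rfl | rfl | rfl | rfl | rfl | rfl | rfl | rfl)
    exacts [a₁.1, a₂.1.1, k₁, crit_neg_snd k₁, k₂, k₂', k₃, crit_neg_snd k₃]
  have hmin : {p : ℝ × ℝ | IsCriticalPt (f14 ε) p ∧ IsLocMin (f14 ε) p} =
      {(-2 / 3, 0), (x₂, y₂), (x₂, -y₂)} := by
    ext p
    constructor
    · rintro ⟨h, hm⟩
      rcases hcover h with rfl | rfl | rfl | rfl | rfl | rfl | rfl | rfl
      exacts [absurd hm a₁.2.1, by simp, absurd hm s₁.1.2.1, absurd hm s₁'.1.2.1, by simp,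
        by simp, absurd hm s₃.1.2.1, absurd hm s₃'.1.2.1]
    · rintro (rfl | rfl | rfl)
      exacts [a₂.1, m₂.1, m₂'.1]
  have hsaddle : {p : ℝ × ℝ | IsSaddle (f14 ε) p} =
      {(-2, 0), (x₁, y₁), (x₁, -y₁), (x₃, y₃), (x₃, -y₃)} := by
    ext p
    constructor
    · rintro ⟨h, hm, -⟩
      rcases hcover h with rfl | rfl | rfl | rfl | rfl | rfl | rfl | rfl
      exacts [by simp, absurd a₂.1.2 hm, by simp, by simp, absurd m₂.1.2 hm, absurd m₂'.1.2 hm,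
        by simp, by simp]
    · rintro (rfl | rfl | rfl | rfl | rfl)
      exacts [a₁, s₁.1, s₁'.1, s₃.1, s₃'.1]
  have n₁₂ : x₁ = x₂ → y₁ ^ 2 ≠ y₂ ^ 2 := fun _ _ => by linarith
  have n₁₃ : x₁ = x₃ → y₁ ^ 2 ≠ y₃ ^ 2 := fun _ _ => by linarith
  have n₂₃ : x₂ = x₃ → y₂ ^ 2 ≠ y₃ ^ 2 := fun _ _ => by linarith
  refine ⟨fun p h => ?_, ?_, ?_, ?_, ?_, fun p h => ?_⟩
  · rcases hcover h with rfl | rfl | rfl | rfl | rfl | rfl | rfl | rfl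
    exacts [a₁', a₂.2.2, s₁.2, s₁'.2, m₂.2.2, m₂'.2.2, s₃.2, s₃'.2]
  · rw [hcrit]
    exact Set.toFinite _
  · rw [hcrit]
    rw [Set.ncard_insert_of_notMem, Set.ncard_insert_of_notMem, Set.ncard_insert_of_notMem,
      Set.ncard_insert_of_notMem, Set.ncard_insert_of_notMem, Set.ncard_insert_of_notMem,
      Set.ncard_insert_of_notMem, Set.ncard_singleton] <;>
    simp only [Set.mem_insert_iff, Set.mem_singleton_iff, Prod.mk.injEq, not_or, not_and] <;>
    clear * - hy₁ hy₂ hy₃ n₁₂ n₁₃ n₂₃ <;>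
    grind
  · rw [hmin]
    repeat rw [Set.ncard_insert_of_notMem (by grind)]
    rw [Set.ncard_singleton]
  · rw [hsaddle]
    rw [Set.ncard_insert_of_notMem, Set.ncard_insert_of_notMem, Set.ncard_insert_of_notMem,
      Set.ncard_insert_of_notMem, Set.ncard_singleton] <;>
    simp only [Set.mem_insert_iff, Set.mem_singleton_iff, Prod.mk.injEq, not_or, not_and] <;>
    clear * - hy₁ hy₂ hy₃ n₁₂ n₁₃ n₂₃ <;>
    grind
  · rcases hcover h with rfl | rfl | rfl | rfl | rfl | rfl | rfl | rfl
    exacts [a₁.2.2, a₂.2.1, s₁.1.2.2, s₁'.1.2.2, m₂.2.1, m₂'.2.1, s₃.1.2.2, s₃'.1.2.2]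
end
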